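/- arXiv:2403.02673 — 4 statements merged into one kernel-verified Lean document; each statement's English description precedes it below -/
import Mathlib

section
/- Let X be an absolutely continuous random variable whose cdf F is continuous and strictly increasing on the support of its density f, with quantile function Q : (0,1) → ℝ satisfying F(Q(u)) = u, and let w : ℝ → [0,∞) be a nonnegative weight function. If n is odd, then the GWE of the extreme ranked set sample satisfies J^w(X_{ERSS}^{(n)}) = (Q̃_{2,n}/2) · (E[Λ_X^w(B_{1:2n-1})])^{(n-1)/2} · (E[Λ_X^w(B_{2n-1:2n-1})])^{(n-1)/2} · E[Λ_X^w(B_{n:2n-1})], where Q̃_{2,n} = -n^{2(n-1)} (n!)^2 ((n-1)!)^2 / ((2n-1)^{n-1} (((n-1)/2)!)^4 (2n-1)!), and B_{2i-1:2n-1} denotes a Beta(2i-1, 2n-2i+1) random variable with density φ_{2i-1:2n-1}(u) = ((2n-1)!/((2i-2)!(2n-2i)!)) u^{2i-2}(1-u)^{2n-2i} on (0,1). -/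
open MeasureTheory Set

/-- Density of the `i`-th order statistic from a sample of size `n`. -/
noncomputable def ordStatDensity (f F : ℝ → ℝ) (n i : ℕ) (x : ℝ) : ℝ :=
  ((Nat.factorial n : ℝ) / ((Nat.factorial (i - 1) : ℝ) * (Nat.factorial (n - i) : ℝ))) *
    (F x) ^ (i - 1) * (1 - F x) ^ (n - i) * f x

/-- General weighted extropy of an extreme ranked set sample of size `n`. -/
noncomputable def JERSS (w f F : ℝ → ℝ) (n : ℕ) : ℝ :=
  if Even n then
    -(1/2) * (∫ x, w x * (ordStatDensity f F n 1 x) ^ 2) ^ (n / 2) *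
      (∫ x, w x * (ordStatDensity f F n n x) ^ 2) ^ (n / 2)
  else
    -(1/2) * (∫ x, w x * (ordStatDensity f F n 1 x) ^ 2) ^ ((n - 1) / 2) *
      (∫ x, w x * (ordStatDensity f F n n x) ^ 2) ^ ((n - 1) / 2) *
      (∫ x, w x * (ordStatDensity f F n ((n + 1) / 2) x) ^ 2)

/-- A density `f` is the image of the uniform distribution on `(0, 1)` under any right inverse `Q`
of its distribution function `F`. -/
theorem withDensity_eq_map_quantile {f F Q : ℝ → ℝ} (hf_nonneg : ∀ x, 0 ≤ f x)
    (hf_int : Integrable f) (hF : ∀ x, F x = ∫ t in Iic x, f t) (hF_le : ∀ x, F x ≤ 1)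
    (hF_mono : Monotone F) (hQ : ∀ u ∈ Ioo (0:ℝ) 1, F (Q u) = u)
    (hQ_meas : Measurable fun u : Ioo (0:ℝ) 1 => Q u) :
    volume.withDensity (fun x => ((f x).toNNReal : ENNReal)) =
      Measure.map (fun u : Ioo (0:ℝ) 1 => Q u) (Measure.comap Subtype.val volume) := by
  have : IsFiniteMeasure (volume.withDensity (fun x => ((f x).toNNReal : ENNReal))) :=
    isFiniteMeasure_withDensity_ofReal hf_int.2
  refine Measure.ext_of_Iic _ _ fun x => ?_
  have hFx : 0 ≤ F x := by rw [hF]; exact integral_nonneg hf_nonneg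
  have hL : volume.withDensity (fun x => ((f x).toNNReal : ENNReal)) (Iic x)
      = ENNReal.ofReal (F x) := by
    rw [withDensity_apply _ measurableSet_Iic, hF,
      ofReal_integral_eq_lintegral_ofReal hf_int.integrableOn
        (Filter.Eventually.of_forall hf_nonneg)]
    rfl
  have hlower : Ioo 0 (F x) ⊆ Subtype.val '' ((fun u : Ioo (0:ℝ) 1 => Q u) ⁻¹' Iic x) := by
    intro u hu
    have hu' : u ∈ Ioo (0:ℝ) 1 := ⟨hu.1, hu.2.trans_le (hF_le x)⟩
    refine ⟨⟨u, hu'⟩, ?_, rfl⟩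
    by_contra h
    have := hF_mono (not_le.1 h).le
    simp only [hQ u hu'] at this
    exact absurd hu.2 (not_lt.2 this)
  have hupper : Subtype.val '' ((fun u : Ioo (0:ℝ) 1 => Q u) ⁻¹' Iic x) ⊆ Ioc 0 (F x) := by
    rintro _ ⟨u, hu, rfl⟩
    exact ⟨u.2.1, (hQ u u.2).symm.le.trans (hF_mono hu)⟩
  rw [hL, Measure.map_apply hQ_meas measurableSet_Iic,
    (MeasurableEmbedding.subtype_coe measurableSet_Ioo).comap_apply]
  apply le_antisymm
  · simpa using measure_mono (μ := volume) hlower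
  · simpa using measure_mono (μ := volume) hupper

/-- The substitution `x = Q u` in an integral against a density `f`; no regularity of the integrand
is needed. -/
theorem integral_mul_density_eq_integral_quantile {f F Q : ℝ → ℝ} (hf_nonneg : ∀ x, 0 ≤ f x)
    (hf_int : Integrable f) (hf_one : ∫ x, f x = 1) (hF : ∀ x, F x = ∫ t in Iic x, f t)
    (hQ : ∀ u ∈ Ioo (0:ℝ) 1, F (Q u) = u) (g : ℝ → ℝ) :
    ∫ x, f x * g x = ∫ u in Ioo (0:ℝ) 1, g (Q u) := by
  have hF_mono : Monotone F := fun x y hxy => by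
    rw [hF, hF]
    exact setIntegral_mono_set hf_int.integrableOn (Filter.Eventually.of_forall hf_nonneg)
      (Iic_subset_Iic.2 hxy).eventuallyLE
  have hF_le : ∀ x, F x ≤ 1 := fun x => by
    rw [hF, ← hf_one]
    exact setIntegral_le_integral hf_int (Filter.Eventually.of_forall hf_nonneg)
  have hQ_strict : StrictMono fun u : Ioo (0:ℝ) 1 => Q u := fun u v huv => by
    by_contra h
    have := hF_mono (not_lt.1 h)
    rw [hQ u u.2, hQ v v.2] at this
    exact absurd huv (not_lt.2 this)
  have hQ_meas : Measurable fun u : Ioo (0:ℝ) 1 => Q u := hQ_strict.monotone.measurable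
  have : StandardBorelSpace (Ioo (0:ℝ) 1) := measurableSet_Ioo.standardBorel
  calc ∫ x, f x * g x = ∫ x, (f x).toNNReal • g x := by
        refine integral_congr_ae (Filter.Eventually.of_forall fun x => ?_)
        simp [NNReal.smul_def, hf_nonneg x]
    _ = ∫ x, g x ∂(volume.withDensity (fun x => ((f x).toNNReal : ENNReal))) :=
        (integral_withDensity_eq_integral_smul₀
          hf_int.aestronglyMeasurable.aemeasurable.real_toNNReal g).symm
    _ = ∫ u : Ioo (0:ℝ) 1, g (Q u) ∂(Measure.comap Subtype.val volume) := by
        rw [withDensity_eq_map_quantile hf_nonneg hf_int hF hF_le hF_mono hQ hQ_meas,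
          (hQ_meas.measurableEmbedding hQ_strict.injective).integral_map]
    _ = ∫ u in Ioo (0:ℝ) 1, g (Q u) :=
        integral_subtype_comap measurableSet_Ioo fun u => g (Q u)

/-- The weighted second moment of an order statistic density, as a multiple of an integral over
`(0, 1)` in terms of the quantile function. -/
theorem integral_weight_mul_ordStatDensity_sq {f F Q : ℝ → ℝ} (hf_nonneg : ∀ x, 0 ≤ f x)
    (hf_int : Integrable f) (hf_one : ∫ x, f x = 1) (hF : ∀ x, F x = ∫ t in Iic x, f t)
    (hQ : ∀ u ∈ Ioo (0:ℝ) 1, F (Q u) = u) (w : ℝ → ℝ) (n i : ℕ) :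
    ∫ x, w x * (ordStatDensity f F n i x) ^ 2 =
      ((n.factorial : ℝ) / ((i - 1).factorial * (n - i).factorial)) ^ 2 *
        ∫ u in Ioo (0:ℝ) 1, (w (Q u) * f (Q u)) * (u ^ (2 * (i - 1)) * (1 - u) ^ (2 * (n - i))) := by
  have h := integral_mul_density_eq_integral_quantile hf_nonneg hf_int hf_one hF hQ
    fun x => w x * f x * (F x ^ (2 * (i - 1)) * (1 - F x) ^ (2 * (n - i)))
  have hcongr : ∫ u in Ioo (0:ℝ) 1,
        w (Q u) * f (Q u) * (F (Q u) ^ (2 * (i - 1)) * (1 - F (Q u)) ^ (2 * (n - i))) =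
      ∫ u in Ioo (0:ℝ) 1,
        (w (Q u) * f (Q u)) * (u ^ (2 * (i - 1)) * (1 - u) ^ (2 * (n - i))) :=
    setIntegral_congr_fun measurableSet_Ioo fun u hu => by simp only [hQ u hu]
  rw [← hcongr, ← h, ← integral_const_mul]
  congr 1
  ext x
  rw [ordStatDensity]
  ring

theorem stmt_2
    (f F Q : ℝ → ℝ)
    (hf_nonneg : ∀ x, 0 ≤ f x)
    (hf_int : Integrable f)
    (hf_one : ∫ x, f x = 1)
    (hF : ∀ x, F x = ∫ t in Iic x, f t)
    (hF_cont : Continuous F)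
    (hF_mono : StrictMonoOn F (Function.support f))
    (hQ : ∀ u ∈ Ioo (0:ℝ) 1, F (Q u) = u)
    (w : ℝ → ℝ) (hw_nonneg : ∀ x, 0 ≤ w x)
    (n : ℕ) (hn : 1 ≤ n) (hno : Odd n) :
    JERSS w f F n =
      (-((n:ℝ) ^ (2 * (n - 1)) * (Nat.factorial n : ℝ) ^ 2 * (Nat.factorial (n - 1) : ℝ) ^ 2) /
          ((2 * (n:ℝ) - 1) ^ (n - 1) * (Nat.factorial ((n - 1) / 2) : ℝ) ^ 4 *
            (Nat.factorial (2 * n - 1) : ℝ))) / 2 *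
        (∫ u in Ioo (0:ℝ) 1,
            (w (Q u) * f (Q u)) * ((2 * (n:ℝ) - 1) * (1 - u) ^ (2 * n - 2))) ^ ((n - 1) / 2) *
        (∫ u in Ioo (0:ℝ) 1,
            (w (Q u) * f (Q u)) * ((2 * (n:ℝ) - 1) * u ^ (2 * n - 2))) ^ ((n - 1) / 2) *
        (∫ u in Ioo (0:ℝ) 1,
            (w (Q u) * f (Q u)) *
              ((Nat.factorial (2 * n - 1) : ℝ) / (Nat.factorial (n - 1) : ℝ) ^ 2 *
                (u ^ (n - 1) * (1 - u) ^ (n - 1)))) := by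
  obtain ⟨m, rfl⟩ := hno
  have key := integral_weight_mul_ordStatDensity_sq hf_nonneg hf_int hf_one hF hQ w (2 * m + 1)
  have hc : ∀ (c : ℝ) (p : ℝ → ℝ), ∫ u in Ioo (0:ℝ) 1, (w (Q u) * f (Q u)) * (c * p u) =
      c * ∫ u in Ioo (0:ℝ) 1, (w (Q u) * f (Q u)) * p u := fun c p => by
    rw [← integral_const_mul]
    congr 1
    ext u
    ring
  have h1 : 2 * m + 1 - 1 = 2 * m := by lia
  have h2 : 2 * m / 2 = m := by lia
  have h3 : (2 * m + 1 + 1) / 2 = m + 1 := by lia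
  have h4 : m + 1 - 1 = m := by lia
  have h5 : 2 * m + 1 - (m + 1) = m := by lia
  have h6 : 2 * (2 * m + 1) - 2 = 2 * (2 * m) := by lia
  have h7 : 2 * (2 * m + 1) - 1 = 4 * m + 1 := by lia
  have hodd : ¬ Even (2 * m + 1) := by simp
  rw [JERSS, if_neg hodd, key, key, key]
  simp only [hc, h1, h2, h3, h4, h5, h6, h7, Nat.sub_self, Nat.factorial_zero, mul_zero, pow_zero,
    one_mul, mul_one, Nat.cast_one]
  set A := ∫ u in Ioo (0:ℝ) 1, (w (Q u) * f (Q u)) * (1 - u) ^ (2 * (2 * m))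
  set B := ∫ u in Ioo (0:ℝ) 1, (w (Q u) * f (Q u)) * u ^ (2 * (2 * m))
  set C := ∫ u in Ioo (0:ℝ) 1, (w (Q u) * f (Q u)) * (u ^ (2 * m) * (1 - u) ^ (2 * m))
  have hfac : ((2 * m + 1).factorial : ℝ) / (2 * m).factorial = (2 * m + 1 : ℕ) := by
    rw [Nat.factorial_succ, Nat.cast_mul, mul_div_cancel_right₀ _ (by positivity)]
  rw [hfac]
  have hN : (2 * ((2 * m + 1 : ℕ) : ℝ) - 1) ≠ 0 := by
    push_cast
    have : (0:ℝ) ≤ m := m.cast_nonneg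
    linarith
  generalize hd : 2 * ((2 * m + 1 : ℕ) : ℝ) - 1 = d at hN ⊢
  generalize ((2 * m + 1 : ℕ) : ℝ) = N
  have hfm : (m.factorial : ℝ) ≠ 0 := by positivity
  have hf2m : ((2 * m).factorial : ℝ) ≠ 0 := by positivity
  have hf4m : ((4 * m + 1).factorial : ℝ) ≠ 0 := by positivity
  simp only [mul_pow]
  field_simp
  ring
end

section
/- Let X be an absolutely continuous random variable with density f and cdf F, and let w_1 : ℝ → [0,∞) be a nonnegative weight function such that ∫ w_1(x) f(x)^2 dx is finite. Then for every even n ≥ 2, J^{w_1}(X_{ERSS}^{(n)}) ≥ n^{2n} · J^{w_1}(X_{SRS}^{(n)}); equivalently, the ratio J^{w_1}(X_{ERSS}^{(n)}) / J^{w_1}(X_{SRS}^{(n)}) is at most n^{2n} whenever J^{w_1}(X_{SRS}^{(n)}) < 0. -/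
open MeasureTheory Set

/-- General weighted extropy of a simple random sample of size `n`. -/
noncomputable def JSRS (w f : ℝ → ℝ) (n : ℕ) : ℝ :=
  -(1/2) * (∫ x, w x * (f x) ^ 2) ^ n

theorem ordStatDensity_one (f F : ℝ → ℝ) {n : ℕ} (hn : n ≠ 0) (x : ℝ) :
    ordStatDensity f F n 1 x = n * (1 - F x) ^ (n - 1) * f x := by
  obtain ⟨k, rfl⟩ := Nat.exists_eq_succ_of_ne_zero hn
  have hk : (k.factorial : ℝ) ≠ 0 := by positivity
  simp [ordStatDensity, Nat.factorial_succ, hk]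

theorem ordStatDensity_self (f F : ℝ → ℝ) {n : ℕ} (hn : n ≠ 0) (x : ℝ) :
    ordStatDensity f F n n x = n * F x ^ (n - 1) * f x := by
  obtain ⟨k, rfl⟩ := Nat.exists_eq_succ_of_ne_zero hn
  have hk : (k.factorial : ℝ) ≠ 0 := by positivity
  simp [ordStatDensity, Nat.factorial_succ, hk]

theorem integral_weight_mul_sq_le {w f g : ℝ → ℝ} (hw : ∀ x, 0 ≤ w x)
    (hwf : Integrable fun x => w x * f x ^ 2) {c : ℝ} {p : ℝ → ℝ}
    (hp₀ : ∀ x, 0 ≤ p x) (hp₁ : ∀ x, p x ≤ 1) (k : ℕ) (hg : ∀ x, g x = c * p x ^ k * f x) :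
    ∫ x, w x * g x ^ 2 ≤ c ^ 2 * ∫ x, w x * f x ^ 2 := by
  rw [← integral_const_mul]
  refine integral_mono_of_nonneg (.of_forall fun x => mul_nonneg (hw x) (sq_nonneg _))
    (hwf.const_mul _) (.of_forall fun x => ?_)
  have hpk : (p x ^ k) ^ 2 ≤ 1 :=
    pow_le_one₀ (pow_nonneg (hp₀ x) k) (pow_le_one₀ (hp₀ x) (hp₁ x))
  calc w x * g x ^ 2 = (p x ^ k) ^ 2 * (c ^ 2 * (w x * f x ^ 2)) := by rw [hg]; ring
    _ ≤ c ^ 2 * (w x * f x ^ 2) :=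
      mul_le_of_le_one_left
        (mul_nonneg (sq_nonneg _) (mul_nonneg (hw x) (sq_nonneg _))) hpk

theorem stmt_5
    (f F w1 : ℝ → ℝ)
    (hf_nonneg : ∀ x, 0 ≤ f x)
    (hf_int : Integrable f)
    (hf_one : ∫ x, f x = 1)
    (hF : ∀ x, F x = ∫ t in Iic x, f t)
    (hw1_nonneg : ∀ x, 0 ≤ w1 x)
    (hwf_int : Integrable (fun x => w1 x * (f x) ^ 2))
    (n : ℕ) (hn : 2 ≤ n) (hne : Even n) :
    (n:ℝ) ^ (2 * n) * JSRS w1 f n ≤ JERSS w1 f F n ∧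
      (JSRS w1 f n < 0 → JERSS w1 f F n / JSRS w1 f n ≤ (n:ℝ) ^ (2 * n)) := by
  have hF₀ : ∀ x, 0 ≤ F x := fun x => by
    rw [hF]
    exact integral_nonneg hf_nonneg
  have hF₁ : ∀ x, F x ≤ 1 := fun x => by
    rw [hF, ← hf_one]
    exact setIntegral_le_integral hf_int (.of_forall hf_nonneg)
  have hn₀ : n ≠ 0 := by omega
  have hmin := integral_weight_mul_sq_le hw1_nonneg hwf_int
    (fun x => sub_nonneg.2 (hF₁ x)) (fun x => sub_le_self 1 (hF₀ x)) (n - 1)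
    (ordStatDensity_one f F hn₀)
  have hmax := integral_weight_mul_sq_le hw1_nonneg hwf_int hF₀ hF₁ (n - 1)
    (ordStatDensity_self f F hn₀)
  have hnonneg : ∀ g : ℝ → ℝ, 0 ≤ ∫ x, w1 x * g x ^ 2 := fun g =>
    integral_nonneg fun x => mul_nonneg (hw1_nonneg x) (sq_nonneg _)
  have hle : (n : ℝ) ^ (2 * n) * JSRS w1 f n ≤ JERSS w1 f F n := by
    have hprod := mul_le_mul (pow_le_pow_left₀ (hnonneg _) hmin (n / 2))
      (pow_le_pow_left₀ (hnonneg _) hmax (n / 2)) (pow_nonneg (hnonneg _) _)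
      (pow_nonneg ((hnonneg _).trans hmin) _)
    rw [← pow_add, show n / 2 + n / 2 = n by obtain ⟨m, rfl⟩ := hne; omega,
      mul_pow, ← pow_mul] at hprod
    rw [JSRS, JERSS, if_pos hne]
    linarith
  exact ⟨hle, fun hneg => (div_le_iff_of_neg hneg).2 hle⟩
end

section
/- Let X be an absolutely continuous random variable with continuous density f, finite mean μ, and cdf F that is continuous and strictly increasing on the support of f (assumed to be an interval), with quantile function Q : (0,1) → ℝ satisfying F(Q(u)) = u. Then f(μ + x) = f(μ - x) for all x ≥ 0 if and only if f(Q(u)) = f(Q(1-u)) for all u ∈ (0,1). -/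
open MeasureTheory Set

section DistributionFunction

variable {f F : ℝ → ℝ}

theorem hasDerivAt_of_eq_integral_Iic (hf_int : Integrable f) (hf_cont : Continuous f)
    (hF : ∀ x, F x = ∫ t in Iic x, f t) (x : ℝ) : HasDerivAt F (f x) x := by
  have h : F = fun x => F 0 + ∫ t in (0 : ℝ)..x, f t := by
    funext y
    have := intervalIntegral.integral_Iic_sub_Iic (μ := volume) (f := f) (a := 0) (b := y)
      hf_int.integrableOn hf_int.integrableOn
    rw [hF y, hF 0, ← this]
    ring
  rw [h]
  exact (hf_cont.integral_hasStrictDerivAt 0 x).hasDerivAt.const_add _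

theorem monotone_of_eq_integral_Iic (hf_nonneg : ∀ x, 0 ≤ f x) (hf_int : Integrable f)
    (hF : ∀ x, F x = ∫ t in Iic x, f t) : Monotone F := by
  intro x y hxy
  rw [hF x, hF y]
  exact setIntegral_mono_set hf_int.integrableOn (ae_of_all _ hf_nonneg)
    (Iic_subset_Iic.2 hxy).eventuallyLE

theorem eq_one_sub_integral_Ioi (hf_int : Integrable f) (hf_one : ∫ x, f x = 1)
    (hF : ∀ x, F x = ∫ t in Iic x, f t) (x : ℝ) : F x = 1 - ∫ t in Ioi x, f t := by
  have := intervalIntegral.integral_Iic_add_Ioi (μ := volume) (f := f) (b := x)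
    hf_int.integrableOn hf_int.integrableOn
  rw [hF x]
  linarith

theorem mem_support_of_cdf_mem_Ioo (hf_int : Integrable f) (hf_one : ∫ x, f x = 1)
    (hsupp : (Function.support f).OrdConnected) (hF : ∀ x, F x = ∫ t in Iic x, f t)
    {x : ℝ} (hx : F x ∈ Ioo (0 : ℝ) 1) : x ∈ Function.support f := by
  by_contra hxS
  by_cases hlow : ∃ y ∈ Function.support f, y ≤ x
  · obtain ⟨y, hy, hyx⟩ := hlow
    have hzero : ∀ t ∈ Ioi x, f t = 0 := by
      intro t ht
      by_contra hft
      exact hxS (hsupp.out hy hft ⟨hyx, le_of_lt ht⟩)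
    have := eq_one_sub_integral_Ioi hf_int hf_one hF x
    rw [setIntegral_eq_zero_of_forall_eq_zero hzero] at this
    linarith [hx.2]
  · have hzero : ∀ t ∈ Iic x, f t = 0 := by
      intro t ht
      by_contra hft
      exact hlow ⟨t, hft, ht⟩
    have := hF x
    rw [setIntegral_eq_zero_of_forall_eq_zero hzero] at this
    linarith [hx.1]

theorem cdf_mem_Ioo_of_mem_support (hf_nonneg : ∀ x, 0 ≤ f x) (hf_int : Integrable f)
    (hf_one : ∫ x, f x = 1) (hf_cont : Continuous f) (hF : ∀ x, F x = ∫ t in Iic x, f t)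
    (hF_mono : StrictMonoOn F (Function.support f))
    {x : ℝ} (hx : x ∈ Function.support f) : F x ∈ Ioo (0 : ℝ) 1 := by
  obtain ⟨a, b, hab, hsub⟩ := mem_nhds_iff_exists_Ioo_subset.1
    (hf_cont.isOpen_support.mem_nhds hx)
  obtain ⟨y, hay, hyx⟩ := exists_between hab.1
  obtain ⟨z, hxz, hzb⟩ := exists_between hab.2
  have h₁ : F y < F x := hF_mono (hsub ⟨hay, hyx.trans hab.2⟩) hx hyx
  have h₂ : F x < F z := hF_mono hx (hsub ⟨hab.1.trans hxz, hzb⟩) hxz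
  have h₃ : 0 ≤ F y := hF y ▸ integral_nonneg hf_nonneg
  have h₄ : 0 ≤ ∫ t in Ioi z, f t := integral_nonneg hf_nonneg
  have h₅ := eq_one_sub_integral_Ioi hf_int hf_one hF z
  exact ⟨by linarith, by linarith⟩

theorem cdf_reflect (hf_int : Integrable f) (hf_one : ∫ x, f x = 1)
    (hF : ∀ x, F x = ∫ t in Iic x, f t) {c : ℝ} (hc : ∀ x, f (c - x) = f x) (x : ℝ) :
    F (c - x) = 1 - F x := by
  have h : ∫ t in Iic (c - x), f t = ∫ t in Ioi x, f t := by
    rw [← integral_Ici_eq_integral_Ioi, ← integral_indicator measurableSet_Iic,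
      ← integral_indicator measurableSet_Ici,
      ← integral_sub_left_eq_self (fun t => (Iic (c - x)).indicator f t) volume c]
    congr 1
    funext t
    have hiff : c - t ∈ Iic (c - x) ↔ t ∈ Ici x := by
      simp only [mem_Iic, mem_Ici, sub_le_sub_iff_left]
    by_cases ht : t ∈ Ici x
    · rw [indicator_of_mem (hiff.2 ht), indicator_of_mem ht, hc]
    · rw [indicator_of_notMem (mt hiff.1 ht), indicator_of_notMem ht]
  rw [eq_one_sub_integral_Ioi hf_int hf_one hF x, hF (c - x), h]
  ring

theorem reflection_center_eq (hf_int : Integrable f) (hf_one : ∫ x, f x = 1)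
    (hmean_int : Integrable (fun x => x * f x)) {c : ℝ} (hc : ∀ x, f (c - x) = f x) :
    c = 2 * ∫ x, x * f x := by
  have h := integral_sub_left_eq_self (fun x => x * f x) volume c
  have h' : ∫ x, (c - x) * f (c - x) = c - ∫ x, x * f x := by
    simp_rw [hc, sub_mul]
    rw [integral_sub (hf_int.const_mul c) hmean_int, integral_const_mul, hf_one, mul_one]
  linarith

end DistributionFunction

theorem stmt_7
    (f F Q : ℝ → ℝ) (μ : ℝ)
    (hf_nonneg : ∀ x, 0 ≤ f x)
    (hf_int : Integrable f)
    (hf_one : ∫ x, f x = 1)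
    (hf_cont : Continuous f)
    (hmean_int : Integrable (fun x => x * f x))
    (hμ : μ = ∫ x, x * f x)
    (hsupp_interval : (Function.support f).OrdConnected)
    (hF : ∀ x, F x = ∫ t in Iic x, f t)
    (hF_cont : Continuous F)
    (hF_mono : StrictMonoOn F (Function.support f))
    (hQ : ∀ u ∈ Ioo (0:ℝ) 1, F (Q u) = u) :
    (∀ x, 0 ≤ x → f (μ + x) = f (μ - x)) ↔
      (∀ u ∈ Ioo (0:ℝ) 1, f (Q u) = f (Q (1 - u))) := by
  have hQS : ∀ u ∈ Ioo (0:ℝ) 1, Q u ∈ Function.support f := fun u hu =>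
    mem_support_of_cdf_mem_Ioo hf_int hf_one hsupp_interval hF ((hQ u hu).symm ▸ hu)
  have hFS : ∀ x ∈ Function.support f, F x ∈ Ioo (0:ℝ) 1 := fun x hx =>
    cdf_mem_Ioo_of_mem_support hf_nonneg hf_int hf_one hf_cont hF hF_mono hx
  have hQF : ∀ x ∈ Function.support f, Q (F x) = x := fun x hx =>
    hF_mono.injOn (hQS _ (hFS x hx)) hx (hQ _ (hFS x hx))
  have hsymm : ∀ u ∈ Ioo (0:ℝ) 1, 1 - u ∈ Ioo (0:ℝ) 1 := fun u hu =>
    ⟨by linarith [hu.2], by linarith [hu.1]⟩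
  constructor
  · intro h u hu
    have hc : ∀ x, f (2 * μ - x) = f x := by
      intro x
      rcases le_total μ x with hx | hx
      · have := h (x - μ) (by linarith)
        ring_nf at this ⊢
        exact this.symm
      · have := h (μ - x) (by linarith)
        ring_nf at this ⊢
        exact this
    have hmem : 2 * μ - Q u ∈ Function.support f := by
      rw [Function.mem_support, hc]
      exact hQS u hu
    have hQ' : Q (1 - u) = 2 * μ - Q u := by
      refine hF_mono.injOn (hQS _ (hsymm u hu)) hmem ?_
      rw [hQ _ (hsymm u hu), cdf_reflect hf_int hf_one hF hc, hQ u hu]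
    rw [hQ', hc]
  · intro h
    have hQmono : StrictMonoOn Q (Ioo 0 1) := by
      intro u hu v hv huv
      refine (monotone_of_eq_integral_Iic hf_nonneg hf_int hF).reflect_lt ?_
      rwa [hQ u hu, hQ v hv]
    have hQimage : Q '' Ioo 0 1 = Function.support f :=
      Subset.antisymm (image_subset_iff.2 hQS) fun x hx => ⟨F x, hFS x hx, hQF x hx⟩
    have hQderiv : ∀ u ∈ Ioo (0:ℝ) 1, HasDerivAt Q (f (Q u))⁻¹ u := by
      intro u hu
      have hnhds : Ioo (0:ℝ) 1 ∈ nhds u := isOpen_Ioo.mem_nhds hu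
      refine HasDerivAt.of_local_left_inverse ?_
        (hasDerivAt_of_eq_integral_Iic hf_int hf_cont hF (Q u)) (hQS u hu)
        (Filter.eventually_of_mem hnhds hQ)
      refine hQmono.continuousAt_of_image_mem_nhds hnhds ?_
      rw [hQimage]
      exact hf_cont.isOpen_support.mem_nhds (hQS u hu)
    have hGderiv : ∀ u ∈ Ioo (0:ℝ) 1, HasDerivAt (fun u => Q u + Q (1 - u)) 0 u := by
      intro u hu
      have h₁ := (hQderiv u hu).add
        ((hQderiv _ (hsymm u hu)).comp u ((hasDerivAt_id u).const_sub 1))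
      rw [h u hu, mul_neg_one, add_neg_cancel] at h₁
      exact h₁
    obtain ⟨c, hc⟩ : ∃ c, ∀ u ∈ Ioo (0:ℝ) 1, Q u + Q (1 - u) = c :=
      isOpen_Ioo.exists_is_const_of_deriv_eq_zero isPreconnected_Ioo
        (fun u hu => (hGderiv u hu).differentiableAt.differentiableWithinAt)
        (fun u hu => (hGderiv u hu).deriv)
    have hcS : ∀ x ∈ Function.support f, f (c - x) = f x := by
      intro x hx
      have h₁ := hc _ (hFS x hx)
      have h₂ := h _ (hFS x hx)
      rw [hQF x hx] at h₁ h₂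
      rw [h₂, ← h₁, add_sub_cancel_left]
    have hcf : ∀ x, f (c - x) = f x := by
      intro x
      by_cases hx : x ∈ Function.support f
      · exact hcS x hx
      · by_cases hx' : c - x ∈ Function.support f
        · simpa using (hcS _ hx').symm
        · rw [Function.notMem_support.1 hx, Function.notMem_support.1 hx']
    have hcμ : c = 2 * μ := hμ ▸ reflection_center_eq hf_int hf_one hmean_int hcf
    intro x _
    rw [← hcf (μ + x), hcμ]
    ring_nf
end

section
/- Let X and Y be nonnegative absolutely continuous random variables with densities f, g and cdfs F, G that are continuous and strictly increasing on their supports, with quantile functions Q_F, Q_G. Let w_1, w_2 : [0,∞) → [0,∞) be nonnegative weight functions, and define Δ(u) = w_1(Q_F(u)) f(Q_F(u)) - w_2(Q_G(u)) g(Q_G(u)), A_1 = {u ∈ (0,1) : Δ(u) > 0}, A_2 = {u ∈ (0,1) : Δ(u) < 0}. Fix n ≥ 1 and suppose that for each Beta density φ appearing in the ERSS representation of size n — namely φ_{1:2n-1}(u) = (2n-1)(1-u)^{2n-2} and φ_{2n-1:2n-1}(u) = (2n-1)u^{2n-2}, together with φ_{n:2n-1}(u) = ((2n-1)!/((n-1)!)^2)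 u^{n-1}(1-u)^{n-1} when n is odd — one has inf_{A_1} φ ≥ sup_{A_2} φ. If J^{w_1}(X) ≤ J^{w_2}(Y), then J^{w_1}(X_{ERSS}^{(n)}) ≤ J^{w_2}(Y_{ERSS}^{(n)}). -/
open MeasureTheory Set

/-- General weighted extropy of a random variable with density `f`. -/
noncomputable def JGWE (w f : ℝ → ℝ) : ℝ :=
  -(1/2) * ∫ x, w x * (f x) ^ 2

/-- The law with density `f` is the image of the uniform law on `(0, 1)` under any quantile
function `Q`. -/
lemma map_quantile_eq_withDensity {f F Q : ℝ → ℝ} (hf0 : ∀ x, 0 ≤ f x) (hfi : Integrable f)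
    (hf1 : ∫ x, f x = 1) (hF : ∀ x, F x = ∫ t in Iic x, f t)
    (hQ : ∀ u ∈ Ioo (0 : ℝ) 1, F (Q u) = u) :
    AEMeasurable Q (volume.restrict (Ioo (0 : ℝ) 1)) ∧
      Measure.map Q (volume.restrict (Ioo (0 : ℝ) 1)) =
        volume.withDensity (fun x => ENNReal.ofReal (f x)) := by
  have hFmono : Monotone F := fun x y hxy => by
    rw [hF, hF]
    exact setIntegral_mono_set hfi.integrableOn (.of_forall hf0) (Iic_subset_Iic.2 hxy).eventuallyLE
  have hF0 : ∀ x, 0 ≤ F x := fun x => by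
    rw [hF]; exact integral_nonneg hf0
  have hF1 : ∀ x, F x ≤ 1 := fun x => by
    rw [hF, ← hf1]; exact setIntegral_le_integral hfi (.of_forall hf0)
  have hQm : AEMeasurable Q (volume.restrict (Ioo (0 : ℝ) 1)) := by
    refine aemeasurable_restrict_of_monotoneOn measurableSet_Ioo fun u hu v hv huv => ?_
    by_contra! h
    have h1 := hFmono h.le
    rw [hQ u hu, hQ v hv] at h1
    exact absurd h (by rw [le_antisymm huv h1]; exact lt_irrefl _)
  refine ⟨hQm, ?_⟩
  have : IsFiniteMeasure (volume.withDensity (fun x => ENNReal.ofReal (f x))) :=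
    isFiniteMeasure_withDensity_ofReal hfi.2
  refine Measure.ext_of_Iic _ _ fun x => ?_
  rw [Measure.map_apply_of_aemeasurable hQm measurableSet_Iic,
    withDensity_apply _ measurableSet_Iic,
    ← ofReal_integral_eq_lintegral_ofReal hfi.integrableOn (.of_forall hf0), ← hF,
    Measure.restrict_apply' measurableSet_Ioo]
  apply le_antisymm
  · calc volume (Q ⁻¹' Iic x ∩ Ioo 0 1) ≤ volume (Icc 0 (F x)) := by
          refine measure_mono fun u hu => ⟨hu.2.1.le, ?_⟩
          rw [← hQ u hu.2]; exact hFmono hu.1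
      _ = ENNReal.ofReal (F x) := by simp
  · calc ENNReal.ofReal (F x) = volume (Ioo 0 (F x)) := by simp
      _ ≤ volume (Q ⁻¹' Iic x ∩ Ioo 0 1) := by
          refine measure_mono fun u hu => ?_
          have hu1 : u ∈ Ioo (0 : ℝ) 1 := ⟨hu.1, hu.2.trans_le (hF1 x)⟩
          refine ⟨?_, hu1⟩
          by_contra h
          have h1 := hFmono (not_le.1 h).le
          rw [hQ u hu1] at h1
          exact absurd hu.2 (not_lt.2 h1)

/-- Quantile substitution for weighted squared densities. -/
lemma integral_mul_sq_mul_comp_eq {w f F Q : ℝ → ℝ} (hf0 : ∀ x, 0 ≤ f x) (hfi : Integrable f)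
    (hf1 : ∫ x, f x = 1) (hF : ∀ x, F x = ∫ t in Iic x, f t) (hFc : Continuous F)
    (hQ : ∀ u ∈ Ioo (0 : ℝ) 1, F (Q u) = u) (hw : Integrable fun x => w x * f x ^ 2)
    {φ : ℝ → ℝ} (hφ : Continuous φ) :
    IntegrableOn (fun u => w (Q u) * f (Q u) * φ u) (Ioo 0 1) ∧
      ∫ x, w x * f x ^ 2 * φ (F x) = ∫ u in Ioo (0 : ℝ) 1, w (Q u) * f (Q u) * φ u := by
  obtain ⟨hQm, hmap⟩ := map_quantile_eq_withDensity hf0 hfi hf1 hF hQ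
  have hfm : AEMeasurable (fun x => ENNReal.ofReal (f x)) := hfi.1.aemeasurable.ennreal_ofReal
  have hp : Integrable (fun x => w x * f x) (Measure.map Q (volume.restrict (Ioo (0 : ℝ) 1))) := by
    rw [hmap, integrable_withDensity_iff_integrable_smul₀' hfm (.of_forall fun _ => by simp)]
    refine hw.congr (.of_forall fun x => ?_)
    simp only [ENNReal.toReal_ofReal (hf0 x), smul_eq_mul]
    ring
  have hpQ : IntegrableOn (fun u => w (Q u) * f (Q u)) (Ioo 0 1) :=
    (integrable_map_measure hp.1 hQm).1 hp
  refine ⟨hpQ.mul_continuousOn_of_subset hφ.continuousOn measurableSet_Ioo isCompact_Icc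
    Ioo_subset_Icc_self, ?_⟩
  calc ∫ x, w x * f x ^ 2 * φ (F x)
      = ∫ x, w x * f x * φ (F x) ∂(volume.withDensity fun x => ENNReal.ofReal (f x)) := by
        rw [integral_withDensity_eq_integral_toReal_smul₀ hfm (.of_forall fun _ => by simp)]
        refine integral_congr_ae (.of_forall fun x => ?_)
        simp only [ENNReal.toReal_ofReal (hf0 x), smul_eq_mul]
        ring
    _ = ∫ u in Ioo (0 : ℝ) 1, w (Q u) * f (Q u) * φ (F (Q u)) := by
        rw [← hmap, integral_map hQm]
        exact hp.1.mul (hφ.comp hFc).aestronglyMeasurable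
    _ = ∫ u in Ioo (0 : ℝ) 1, w (Q u) * f (Q u) * φ u :=
        setIntegral_congr_fun measurableSet_Ioo fun u hu => by simp only [hQ u hu]

/-- Weighted integral of the squared density of an order statistic as an integral against a
polynomial in the cdf. -/
lemma mul_ordStatDensity_sq (w f F : ℝ → ℝ) (n i : ℕ) (x : ℝ) :
    w x * ordStatDensity f F n i x ^ 2 = w x * f x ^ 2 *
      (fun u : ℝ => ((n.factorial : ℝ) / (((i - 1).factorial : ℝ) * ((n - i).factorial : ℝ)) *
        u ^ (i - 1) * (1 - u) ^ (n - i)) ^ 2) (F x) := by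
  simp only [ordStatDensity]
  ring

lemma integrable_of_integrable_extreme {w f F : ℝ → ℝ} (hFc : Continuous F) {n : ℕ}
    (h1 : Integrable fun x => w x * ordStatDensity f F n 1 x ^ 2)
    (hn : Integrable fun x => w x * ordStatDensity f F n n x ^ 2) :
    Integrable fun x => w x * f x ^ 2 := by
  set C : ℝ := (n.factorial : ℝ) / ((n - 1).factorial : ℝ) with hC
  have hCpos : 0 < C := by positivity
  set B : ℝ → ℝ := fun x => C ^ 2 * (((1 - F x) ^ (n - 1)) ^ 2 + (F x ^ (n - 1)) ^ 2) with hB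
  set c : ℝ := C ^ 2 * ((1 / 2) ^ (n - 1)) ^ 2 with hc
  have hcpos : 0 < c := by positivity
  have hBc : ∀ x, c ≤ B x := fun x => by
    refine mul_le_mul_of_nonneg_left ?_ (by positivity)
    rcases le_total (1 / 2) (F x) with h | h
    · have : ((1 / 2 : ℝ) ^ (n - 1)) ^ 2 ≤ (F x ^ (n - 1)) ^ 2 := by gcongr
      nlinarith [sq_nonneg ((1 - F x) ^ (n - 1))]
    · have : ((1 / 2 : ℝ) ^ (n - 1)) ^ 2 ≤ ((1 - F x) ^ (n - 1)) ^ 2 := by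
        gcongr
        linarith
      nlinarith [sq_nonneg (F x ^ (n - 1))]
  have hBcont : Continuous B := by fun_prop
  have hBinv : Continuous fun x => (B x)⁻¹ :=
    hBcont.inv₀ fun x => (hcpos.trans_le (hBc x)).ne'
  refine ((h1.add hn).bdd_mul (c := c⁻¹) hBinv.aestronglyMeasurable
    (.of_forall fun x => ?_)).congr (.of_forall fun x => ?_)
  · rw [Real.norm_of_nonneg (inv_nonneg.2 (hcpos.trans_le (hBc x)).le)]
    exact inv_anti₀ hcpos (hBc x)
  · have hx : B x ≠ 0 := (hcpos.trans_le (hBc x)).ne'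
    have : w x * ordStatDensity f F n 1 x ^ 2 + w x * ordStatDensity f F n n x ^ 2
        = B x * (w x * f x ^ 2) := by
      simp only [mul_ordStatDensity_sq, hB, hC]
      simp
      ring
    simp only [Pi.add_apply]
    rw [this, inv_mul_cancel_left₀ hx]

lemma JERSS_mono {w₁ w₂ f g F G : ℝ → ℝ} {n : ℕ}
    (h0 : ∀ i, 0 ≤ ∫ x, w₂ x * ordStatDensity g G n i x ^ 2)
    (h : ∀ i, ∫ x, w₂ x * ordStatDensity g G n i x ^ 2 ≤
      ∫ x, w₁ x * ordStatDensity f F n i x ^ 2) :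
    JERSS w₁ f F n ≤ JERSS w₂ g G n := by
  have h0' := fun i => (h0 i).trans (h i)
  have hpow := fun i k => pow_le_pow_left₀ (h0 i) (h i) k
  unfold JERSS
  split_ifs
  · simp only [mul_assoc]
    exact mul_le_mul_of_nonpos_left
      (mul_le_mul (hpow _ _) (hpow _ _) (pow_nonneg (h0 _) _) (pow_nonneg (h0' _) _)) (by norm_num)
  · simp only [mul_assoc]
    exact mul_le_mul_of_nonpos_left
      (mul_le_mul (hpow _ _)
        (mul_le_mul (hpow _ _) (h _) (h0 _) (pow_nonneg (h0' _) _))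
        (mul_nonneg (pow_nonneg (h0 _) _) (h0 _)) (pow_nonneg (h0' _) _)) (by norm_num)

lemma JERSS_nonpos {w f F : ℝ → ℝ} {n : ℕ}
    (h0 : ∀ i, 0 ≤ ∫ x, w x * ordStatDensity f F n i x ^ 2) : JERSS w f F n ≤ 0 := by
  unfold JERSS
  split_ifs
  · simp only [mul_assoc]
    exact mul_nonpos_of_nonpos_of_nonneg (by norm_num)
      (mul_nonneg (pow_nonneg (h0 _) _) (pow_nonneg (h0 _) _))
  · simp only [mul_assoc]
    exact mul_nonpos_of_nonpos_of_nonneg (by norm_num)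
      (mul_nonneg (pow_nonneg (h0 _) _) (mul_nonneg (pow_nonneg (h0 _) _) (h0 _)))

lemma JERSS_eq_zero {w f F : ℝ → ℝ} {n : ℕ} (hn : 2 ≤ n)
    (h : ∫ x, w x * ordStatDensity f F n 1 x ^ 2 = 0 ∨
      ∫ x, w x * ordStatDensity f F n n x ^ 2 = 0) : JERSS w f F n = 0 := by
  unfold JERSS
  split_ifs with he
  · have : n / 2 ≠ 0 := by omega
    rcases h with h | h <;> simp [h, this]
  · have : (n - 1) / 2 ≠ 0 := by
      rw [Nat.not_even_iff] at he
      omega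
    rcases h with h | h <;> simp only [h, zero_pow this, mul_zero, zero_mul]

lemma JERSS_one (w f F : ℝ → ℝ) : JERSS w f F 1 = JGWE w f := by
  simp [JERSS, JGWE, ordStatDensity]

theorem stmt_16
    (f g F G QF QG : ℝ → ℝ) (w1 w2 : ℝ → ℝ)
    (hf_nonneg : ∀ x, 0 ≤ f x) (hf_int : Integrable f) (hf_one : ∫ x, f x = 1)
    (hg_nonneg : ∀ x, 0 ≤ g x) (hg_int : Integrable g) (hg_one : ∫ x, g x = 1)
    (hf_supp : ∀ x < (0:ℝ), f x = 0) (hg_supp : ∀ x < (0:ℝ), g x = 0)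
    (hF : ∀ x, F x = ∫ t in Iic x, f t) (hG : ∀ x, G x = ∫ t in Iic x, g t)
    (hF_cont : Continuous F) (hG_cont : Continuous G)
    (hF_mono : StrictMonoOn F (Function.support f))
    (hG_mono : StrictMonoOn G (Function.support g))
    (hQF : ∀ u ∈ Ioo (0:ℝ) 1, F (QF u) = u)
    (hQG : ∀ u ∈ Ioo (0:ℝ) 1, G (QG u) = u)
    (hw1_nonneg : ∀ x, 0 ≤ x → 0 ≤ w1 x)
    (hw2_nonneg : ∀ x, 0 ≤ x → 0 ≤ w2 x)
    (n : ℕ) (hn : 1 ≤ n)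
    (Δ : ℝ → ℝ)
    (hΔ : ∀ u, Δ u = w1 (QF u) * f (QF u) - w2 (QG u) * g (QG u))
    (hsep1 : ∀ u ∈ Ioo (0:ℝ) 1, ∀ v ∈ Ioo (0:ℝ) 1, 0 < Δ u → Δ v < 0 →
      (2 * (n:ℝ) - 1) * (1 - v) ^ (2 * n - 2) ≤ (2 * (n:ℝ) - 1) * (1 - u) ^ (2 * n - 2))
    (hsep2 : ∀ u ∈ Ioo (0:ℝ) 1, ∀ v ∈ Ioo (0:ℝ) 1, 0 < Δ u → Δ v < 0 →
      (2 * (n:ℝ) - 1) * v ^ (2 * n - 2) ≤ (2 * (n:ℝ) - 1) * u ^ (2 * n - 2))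
    (hsep3 : Odd n → ∀ u ∈ Ioo (0:ℝ) 1, ∀ v ∈ Ioo (0:ℝ) 1, 0 < Δ u → Δ v < 0 →
      (Nat.factorial (2 * n - 1) : ℝ) / (Nat.factorial (n - 1) : ℝ) ^ 2 *
          (v ^ (n - 1) * (1 - v) ^ (n - 1)) ≤
        (Nat.factorial (2 * n - 1) : ℝ) / (Nat.factorial (n - 1) : ℝ) ^ 2 *
          (u ^ (n - 1) * (1 - u) ^ (n - 1)))
    (hJ : JGWE w1 f ≤ JGWE w2 g) :
    JERSS w1 f F n ≤ JERSS w2 g G n := by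
  obtain rfl | hn2 : n = 1 ∨ 2 ≤ n := by omega
  · rwa [JERSS_one, JERSS_one]
  have hnn : ∀ {w f : ℝ → ℝ}, (∀ x, 0 ≤ x → 0 ≤ w x) → (∀ x < (0 : ℝ), f x = 0) →
      ∀ x, 0 ≤ w x * f x ^ 2 := fun {w f} hw hf x => by
    rcases lt_or_ge x 0 with h | h
    · simp [hf x h]
    · exact mul_nonneg (hw x h) (sq_nonneg _)
  have hK1 : ∀ i, 0 ≤ ∫ x, w1 x * ordStatDensity f F n i x ^ 2 := fun i =>
    integral_nonneg (hnn hw1_nonneg fun x hx => by simp [ordStatDensity, hf_supp x hx])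
  have hK2 : ∀ i, 0 ≤ ∫ x, w2 x * ordStatDensity g G n i x ^ 2 := fun i =>
    integral_nonneg (hnn hw2_nonneg fun x hx => by simp [ordStatDensity, hg_supp x hx])
  have hle : ∫ x, w2 x * g x ^ 2 ≤ ∫ x, w1 x * f x ^ 2 := by
    simp only [JGWE] at hJ
    linarith
  by_cases hi2 : Integrable fun x => w2 x * g x ^ 2
  swap
  · rw [JERSS_eq_zero (w := w2) hn2]
    · exact JERSS_nonpos hK1
    · by_contra! h
      exact hi2 (integrable_of_integrable_extreme hG_cont
        (not_imp_comm.1 integral_undef h.1) (not_imp_comm.1 integral_undef h.2))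
  by_cases hi1 : Integrable fun x => w1 x * f x ^ 2
  swap
  · rw [JERSS_eq_zero (w := w2) hn2]
    · exact JERSS_nonpos hK1
    · left
      rw [integral_undef hi1] at hle
      have hz := (integral_eq_zero_iff_of_nonneg (hnn hw2_nonneg hg_supp) hi2).1
        (hle.antisymm (integral_nonneg (hnn hw2_nonneg hg_supp)))
      refine integral_eq_zero_of_ae (hz.mono fun x hx => ?_)
      simp only [Pi.zero_apply] at hx
      simp only [mul_ordStatDensity_sq, hx, zero_mul, Pi.zero_apply]
  have hcv1 := fun {φ : ℝ → ℝ} (hφ : Continuous φ) =>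
    integral_mul_sq_mul_comp_eq hf_nonneg hf_int hf_one hF hF_cont hQF hi1 hφ
  have hcv2 := fun {φ : ℝ → ℝ} (hφ : Continuous φ) =>
    integral_mul_sq_mul_comp_eq hg_nonneg hg_int hg_one hG hG_cont hQG hi2 hφ
  have hΔ0 : ∀ᵐ u ∂(volume.restrict (Ioo (0 : ℝ) 1)),
      w2 (QG u) * g (QG u) ≤ w1 (QF u) * f (QF u) := by
    by_cases hA2 : ∃ v ∈ Ioo (0 : ℝ) 1, Δ v < 0
    · obtain ⟨v, hv, hv0⟩ := hA2
      have hA1 : ∀ u ∈ Ioo (0 : ℝ) 1, Δ u ≤ 0 := fun u hu => by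
        by_contra! hu0
        have hc : (0 : ℝ) < 2 * n - 1 := by
          have : (2 : ℝ) ≤ n := by exact_mod_cast hn2
          linarith
        have hm : 2 * n - 2 ≠ 0 := by omega
        have e1 := le_of_mul_le_mul_left (hsep1 u hu v hv hu0 hv0) hc
        have e2 := le_of_mul_le_mul_left (hsep2 u hu v hv hu0 hv0) hc
        rw [pow_le_pow_iff_left₀ (by linarith [hv.2]) (by linarith [hu.2]) hm] at e1
        rw [pow_le_pow_iff_left₀ hv.1.le hu.1.le hm] at e2
        obtain rfl : u = v := by linarith
        linarith
      obtain ⟨j1, k1⟩ := hcv1 (φ := fun _ => 1) continuous_const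
      obtain ⟨j2, k2⟩ := hcv2 (φ := fun _ => 1) continuous_const
      simp only [mul_one] at j1 k1 j2 k2
      have hd : 0 ≤ᵐ[volume.restrict (Ioo (0 : ℝ) 1)]
          fun u => w2 (QG u) * g (QG u) - w1 (QF u) * f (QF u) :=
        (ae_restrict_iff' measurableSet_Ioo).2 (.of_forall fun u hu => by
          have := hA1 u hu
          rw [hΔ] at this
          simp only [Pi.zero_apply]
          linarith)
      have hz := (integral_eq_zero_iff_of_nonneg_ae hd (j2.sub j1)).1
        (le_antisymm (by
          rw [integral_sub j2 j1, ← k1, ← k2]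
          linarith) (integral_nonneg_of_ae hd))
      filter_upwards [hz] with u hu
      simp only [Pi.zero_apply] at hu
      linarith
    · push Not at hA2
      refine (ae_restrict_iff' measurableSet_Ioo).2 (.of_forall fun u hu => ?_)
      have := hA2 u hu
      rw [hΔ] at this
      linarith
  refine JERSS_mono hK2 fun i => ?_
  have hφ : Continuous fun u : ℝ =>
      ((n.factorial : ℝ) / (((i - 1).factorial : ℝ) * ((n - i).factorial : ℝ)) *
        u ^ (i - 1) * (1 - u) ^ (n - i)) ^ 2 := by fun_prop
  simp only [mul_ordStatDensity_sq]
  refine (hcv2 hφ).2.trans_le (le_of_le_of_eq ?_ (hcv1 hφ).2.symm)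
  refine integral_mono_ae (hcv2 hφ).1 (hcv1 hφ).1 ?_
  filter_upwards [hΔ0] with u hu
  exact mul_le_mul_of_nonneg_right hu (sq_nonneg _)
end
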